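/- arXiv:1109.1580 — 5 statements merged into one kernel-verified Lean document; each statement's English description precedes it below -/
import Mathlib

section
/- Let k be a field with a normalized discrete valuation v, let p be a prime number with char k ≠ p, let a ∈ k^× with p not dividing v(a), and let r, m ≥ 1. If α is a root of the polynomial x^{p^m} − a, then μ_{p^r}(k(α)) = μ_{p^r}(k); that is, every p^r-th root of unity contained in k(α) already lies in k. -/
open Polynomial IntermediateField

/-- A normalized discrete (additive) valuation on a field `k`: a surjective map
`k^× → ℤ` with `v(xy) = v(x) + v(y)` and `v(x+y) ≥ min (v x) (v y)`. -/
structure IsNormalizedDiscreteValuation {k : Type*} [Field k] (v : k → ℤ) : Prop where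
  surj : ∀ n : ℤ, ∃ x : k, x ≠ 0 ∧ v x = n
  map_mul : ∀ x y : k, x ≠ 0 → y ≠ 0 → v (x * y) = v x + v y
  min_le_map_add : ∀ x y : k, x ≠ 0 → y ≠ 0 → x + y ≠ 0 → min (v x) (v y) ≤ v (x + y)

universe u

/-- Over a field containing a square root of `-1`, the polynomial `X ^ 2 ^ n - a` is irreducible
as soon as `a` is not a square. -/
theorem X_pow_two_pow_sub_C_irreducible {F : Type u} [Field F] {i : F} (hi : i ^ 2 = -1)
    (n : ℕ) {a : F} (ha : ∀ b : F, b ^ 2 ≠ a) : Irreducible (X ^ 2 ^ n - C a) := by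
  induction n generalizing F with
  | zero => simpa using irreducible_X_sub_C a
  | succ n ih =>
    rw [pow_succ]
    have h2 := X_pow_sub_C_irreducible_of_prime Nat.prime_two ha
    refine X_pow_mul_sub_C_irreducible h2 fun E _ _ x hx ↦ ?_
    refine ih (i := algebraMap F _ i) (by rw [← map_pow, hi, map_neg, map_one]) fun b hb ↦ ?_
    have hx0 : IsIntegral F x := by
      by_contra h
      rw [minpoly.eq_zero h] at hx
      exact X_pow_sub_C_ne_zero two_pos a hx.symm
    refine ha (i * Algebra.norm F b) ?_
    rw [mul_pow, hi, ← map_pow, hb, ← adjoin.powerBasis_gen hx0,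
      Algebra.PowerBasis.norm_gen_eq_coeff_zero_minpoly]
    simp [minpoly_gen, hx]

theorem X_pow_prime_pow_sub_C_irreducible {F : Type u} [Field F] {p : ℕ} (hp : p.Prime)
    (hi : p = 2 → ∃ i : F, i ^ 2 = -1) (n : ℕ) {a : F} (ha : ∀ b : F, b ^ p ≠ a) :
    Irreducible (X ^ p ^ n - C a) := by
  by_cases h2 : p = 2
  · obtain ⟨i, hi'⟩ := hi h2
    subst h2
    exact X_pow_two_pow_sub_C_irreducible hi' n ha
  · exact X_pow_sub_C_irreducible_of_prime_pow hp h2 n ha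

section Degree

variable {k L : Type*} [Field k] [Field L] [Algebra k L] {n : ℕ} {a : k} {α : L}

theorem isIntegral_of_pow_eq_algebraMap (hn : n ≠ 0) (hα : α ^ n = algebraMap k L a) :
    IsIntegral k α :=
  ⟨X ^ n - C a, monic_X_pow_sub_C a hn, by simp [hα]⟩

theorem minpoly_eq_X_pow_sub_C (hn : n ≠ 0) (hα : α ^ n = algebraMap k L a)
    (H : Irreducible (X ^ n - C a)) : minpoly k α = X ^ n - C a :=
  (minpoly.eq_of_irreducible_of_monic H (by simp [hα]) (monic_X_pow_sub_C a hn)).symm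

theorem finrank_of_irreducible_X_pow_sub_C (hn : n ≠ 0) (hα : α ^ n = algebraMap k L a)
    (hgen : k⟮α⟯ = ⊤) (H : Irreducible (X ^ n - C a)) : Module.finrank k L = n := by
  rw [← finrank_top', ← hgen, adjoin.finrank (isIntegral_of_pow_eq_algebraMap hn hα),
    minpoly_eq_X_pow_sub_C hn hα H, natDegree_X_pow_sub_C]

theorem finrank_le_of_pow_eq_algebraMap (hn : n ≠ 0) (hα : α ^ n = algebraMap k L a)
    (hgen : k⟮α⟯ = ⊤) : Module.finrank k L ≤ n := by
  rw [← finrank_top', ← hgen, adjoin.finrank (isIntegral_of_pow_eq_algebraMap hn hα)]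
  refine (natDegree_le_of_dvd (minpoly.dvd k α (p := X ^ n - C a) (by simp [hα]))
    (X_pow_sub_C_ne_zero hn.bot_lt a)).trans_eq natDegree_X_pow_sub_C

end Degree

/-- Kummer theory in prime degree: if `F = k(ζ)` with `ζ ^ p = c` has degree `p` over `k ⊇ μ_p`,
then every element of `k` that becomes a `p`-th power in `F` has the form `b ^ p * c ^ j`. -/
theorem exists_eq_pow_mul_pow_of_isPow {k F : Type*} [Field k] [Field F] [Algebra k F] {p : ℕ}
    (hp : p.Prime) {ω c a : k} (hω : IsPrimitiveRoot ω p) {ζ γ : F}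
    (H : Irreducible (X ^ p - C c)) (hζ : ζ ^ p = algebraMap k F c) (hgen : k⟮ζ⟯ = ⊤)
    (hc : c ≠ 0) (hγ : γ ^ p = algebraMap k F a) : ∃ (b : k) (j : ℕ), a = b ^ p * c ^ j := by
  by_cases hγ0 : γ = 0
  · refine ⟨0, 0, (algebraMap k F).injective ?_⟩
    simp [← hγ, hγ0, hp.ne_zero]
  have hfin := finrank_of_irreducible_X_pow_sub_C hp.ne_zero hζ hgen H
  have : FiniteDimensional k F := .of_finrank_pos (hfin ▸ hp.pos)
  have : NeZero p := ⟨hp.ne_zero⟩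
  have hprim : (primitiveRoots p k).Nonempty := ⟨ω, (mem_primitiveRoots hp.pos).2 hω⟩
  have hsplit : IsSplittingField k F (X ^ p - C c) := by
    subst hfin
    exact isSplittingField_X_pow_sub_C_of_root_adjoin_eq_top hprim hζ hgen
  have := isGalois_of_isSplittingField_X_pow_sub_C hprim H F
  have hζ0 : ζ ≠ 0 := by
    rintro rfl
    rw [zero_pow hp.ne_zero] at hζ
    exact hc ((map_eq_zero _).1 hζ.symm)
  let e := autEquivZmod H F hω
  let σ := e.symm (Multiplicative.ofAdd (1 : ZMod p))
  have hσ : σ ζ = algebraMap k F ω * ζ := by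
    simpa [σ, e, Algebra.smul_def] using autEquivZmod_symm_apply_natCast H F hζ hω 1
  have hgenσ (τ : Gal(F/k)) : τ ∈ Subgroup.zpowers σ := by
    have hcard : Nat.card Gal(F/k) = p := by rw [IsGalois.card_aut_eq_finrank, hfin]
    have : Fact p.Prime := ⟨hp⟩
    refine mem_zpowers_of_prime_card hcard fun h ↦ ?_
    rw [h, AlgEquiv.one_apply] at hσ
    have h1 : algebraMap k F ω = 1 := mul_right_cancel₀ hζ0 (by rw [← hσ, one_mul])
    exact hω.ne_one hp.one_lt ((map_eq_one_iff _ (algebraMap k F).injective).1 h1)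
  obtain ⟨j, -, hj⟩ := (hω.map_of_injective (algebraMap k F).injective).eq_pow_of_pow_eq_one
    (ξ := σ γ / γ) (by rw [div_pow, ← map_pow, hγ, AlgEquiv.commutes, ← hγ,
      div_self (pow_ne_zero _ hγ0)])
  have hσγ : σ γ = algebraMap k F ω ^ j * γ := by rw [hj, div_mul_cancel₀ _ hγ0]
  have hω0 : algebraMap k F ω ≠ 0 := (_root_.map_ne_zero _).2 (hω.ne_zero hp.ne_zero)
  have hfix : σ (γ / ζ ^ j) = γ / ζ ^ j := by
    rw [map_div₀, map_pow, hσ, hσγ, mul_pow, mul_div_mul_left _ _ (pow_ne_zero _ hω0)]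
  obtain ⟨b, hb⟩ := (IsGalois.mem_range_algebraMap_iff_fixed (F := k) (γ / ζ ^ j)).2 fun τ ↦ by
    have hle : Subgroup.zpowers σ ≤ MulAction.stabilizer Gal(F/k) (γ / ζ ^ j) := by
      rw [Subgroup.zpowers_le]
      exact hfix
    exact hle (hgenσ τ)
  refine ⟨b, j, (algebraMap k F).injective ?_⟩
  rw [map_mul, map_pow, map_pow, hb, ← hγ, ← hζ, div_pow, ← pow_mul, ← pow_mul, mul_comm p j,
    div_mul_cancel₀ _ (pow_ne_zero _ hζ0)]

namespace IsNormalizedDiscreteValuation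

variable {k : Type*} [Field k] {v : k → ℤ}

theorem map_one (hv : IsNormalizedDiscreteValuation v) : v 1 = 0 := by
  have := hv.map_mul 1 1 one_ne_zero one_ne_zero
  rw [mul_one] at this
  lia

theorem map_pow (hv : IsNormalizedDiscreteValuation v) {x : k} (hx : x ≠ 0) (n : ℕ) :
    v (x ^ n) = n * v x := by
  induction n with
  | zero => simp [hv.map_one]
  | succ n ih =>
    rw [pow_succ, hv.map_mul _ _ (pow_ne_zero n hx) hx, ih]
    push_cast
    ring

theorem map_eq_zero_of_pow_eq_one (hv : IsNormalizedDiscreteValuation v) {x : k} {n : ℕ}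
    (hn : n ≠ 0) (hx : x ^ n = 1) : v x = 0 := by
  have hx0 : x ≠ 0 := by
    rintro rfl
    simp [hn] at hx
  have h := hv.map_pow hx0 n
  rw [hx, hv.map_one] at h
  simpa [hn] using h.symm

theorem dvd_map_pow_mul (hv : IsNormalizedDiscreteValuation v) {b c : k} {n : ℕ}
    (h : b ^ n * c ≠ 0) (hc : v c = 0) : (n : ℤ) ∣ v (b ^ n * c) := by
  by_cases hn : n = 0
  · simp [hn, hc]
  have hb : b ≠ 0 := by
    rintro rfl
    simp [hn] at h
  rw [hv.map_mul _ _ (left_ne_zero_of_mul h) (right_ne_zero_of_mul h), hv.map_pow hb, hc, add_zero]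
  exact dvd_mul_right _ _

end IsNormalizedDiscreteValuation

section RadicalExtension

variable {k L : Type*} [Field k] [Field L] [Algebra k L] {p : ℕ} {a : k} {α : L}

/-- Let `α ^ p ^ m = a` and suppose that `k` contains a primitive `p`-th root of unity. If `ζ` in
`k(α)` is a `p`-th root of `c` in `k` and `a` is not of the form `b ^ p * c ^ j`, then `ζ` lies in
`k`. For `p = 2` this needs a square root of `-1` in `k(ζ)`. -/
theorem mem_range_algebraMap_of_pow_eq (hp : p.Prime) {ω : k} (hω : IsPrimitiveRoot ω p) {m : ℕ}
    (hα : α ^ p ^ m = algebraMap k L a) (hgen : k⟮α⟯ = ⊤) {ζ : L} {c : k} (hc : c ≠ 0)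
    (hζ : ζ ^ p = algebraMap k L c) (ha : ∀ (b : k) (j : ℕ), a ≠ b ^ p * c ^ j)
    (hi : p = 2 → ∃ i : k⟮ζ⟯, i ^ 2 = -1) : ζ ∈ Set.range (algebraMap k L) := by
  have hpm : p ^ m ≠ 0 := pow_ne_zero _ hp.ne_zero
  have : NeZero p := ⟨hp.ne_zero⟩
  by_contra hζk
  have H : Irreducible (X ^ p - C c) := by
    refine X_pow_sub_C_irreducible_of_prime hp fun b hb ↦ hζk ?_
    have hb0 : algebraMap k L b ≠ 0 := by
      rw [_root_.map_ne_zero]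
      rintro rfl
      exact hc (by rw [← hb, zero_pow hp.ne_zero])
    obtain ⟨i, -, hi⟩ := (hω.map_of_injective (algebraMap k L).injective).eq_pow_of_pow_eq_one
      (ξ := ζ / algebraMap k L b) (by
        rw [div_pow, hζ, ← hb, map_pow, div_self (pow_ne_zero _ hb0)])
    exact ⟨ω ^ i * b, by rw [map_mul, map_pow, hi, div_mul_cancel₀ _ hb0]⟩
  have hint := isIntegral_of_pow_eq_algebraMap hp.ne_zero hζ
  have hgenζ : k⟮AdjoinSimple.gen k ζ⟯ = ⊤ :=
    adjoin_eq_top_of_algebra _ _ (adjoin.powerBasis hint).adjoin_gen_eq_top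
  have hζF : AdjoinSimple.gen k ζ ^ p = algebraMap k k⟮ζ⟯ c := Subtype.ext hζ
  have hαF : α ^ p ^ m = algebraMap k⟮ζ⟯ L (algebraMap k k⟮ζ⟯ a) := hα
  have hnot : ¬ Irreducible (X ^ p ^ m - C (algebraMap k k⟮ζ⟯ a)) := fun hirr ↦ by
    have h1 := finrank_of_irreducible_X_pow_sub_C hpm hαF
      (adjoin_eq_top_of_adjoin_eq_top k hgen) hirr
    have h2 := finrank_of_irreducible_X_pow_sub_C hp.ne_zero hζF hgenζ H
    have h3 := Module.finrank_mul_finrank k k⟮ζ⟯ L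
    have h4 := finrank_le_of_pow_eq_algebraMap hpm hα hgen
    rw [← h3, h1, h2] at h4
    exact (Nat.mul_lt_mul_of_pos_right hp.one_lt hpm.bot_lt).not_ge (by simpa using h4)
  have hpow : ∃ γ : k⟮ζ⟯, γ ^ p = algebraMap k k⟮ζ⟯ a := by
    by_contra! h
    exact hnot (X_pow_prime_pow_sub_C_irreducible hp hi m h)
  obtain ⟨γ, hγ⟩ := hpow
  obtain ⟨b, j, hbj⟩ := exists_eq_pow_mul_pow_of_isPow hp hω H hζF hgenζ hc hγ
  exact ha b j hbj

/-- A primitive `p`-th root of unity in `k(α)` comes from `k`, since its degree over `k` is less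
than `p` but divides a power of `p`. -/
theorem IsPrimitiveRoot.mem_range_algebraMap_of_radical (hp : p.Prime) (hp2 : p ≠ 2) {m : ℕ}
    (hα : α ^ p ^ m = algebraMap k L a) (hgen : k⟮α⟯ = ⊤) (ha : ∀ b : k, b ^ p ≠ a) {ω : L}
    (hω : IsPrimitiveRoot ω p) : ω ∈ Set.range (algebraMap k L) := by
  have hpm : p ^ m ≠ 0 := pow_ne_zero _ hp.ne_zero
  have hfin := finrank_of_irreducible_X_pow_sub_C hpm hα hgen
    (X_pow_sub_C_irreducible_of_prime_pow hp hp2 m ha)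
  have hint : IsIntegral k ω := hω.isIntegral hp.pos |>.tower_top
  obtain ⟨t, -, ht⟩ := (Nat.dvd_prime_pow hp).1 (hfin ▸ minpoly.degree_dvd hint)
  have hlt : (minpoly k ω).natDegree < p := by
    have hroot : aeval ω (cyclotomic p k) = 0 := by
      rw [aeval_def, eval₂_eq_eval_map, map_cyclotomic]
      exact hω.isRoot_cyclotomic hp.pos
    calc (minpoly k ω).natDegree ≤ (cyclotomic p k).natDegree :=
          natDegree_le_of_dvd (minpoly.dvd k ω hroot) (cyclotomic_ne_zero p k)
      _ = p - 1 := by rw [natDegree_cyclotomic, Nat.totient_prime hp]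
      _ < p := Nat.sub_one_lt hp.ne_zero
  have ht0 : t = 0 := by
    by_contra h
    exact hlt.not_ge (ht ▸ Nat.le_self_pow h p)
  rw [ht0, pow_zero] at ht
  exact minpoly.natDegree_eq_one_iff.1 ht

end RadicalExtension

theorem exists_isPrimitiveRoot_pow_of_pow_prime_pow_eq_one {M : Type*} [CommMonoid M] {p : ℕ}
    (hp : p.Prime) {ζ : M} {n : ℕ} (h : ζ ^ p ^ n = 1) (h1 : ζ ≠ 1) :
    ∃ t : ℕ, IsPrimitiveRoot (ζ ^ p ^ t) p := by
  obtain ⟨s, -, hs⟩ := (Nat.dvd_prime_pow hp).1 (orderOf_dvd_of_pow_eq_one h)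
  cases s with
  | zero => exact absurd (orderOf_eq_one_iff.1 (by simpa using hs)) h1
  | succ t =>
    refine ⟨t, (IsPrimitiveRoot.orderOf ζ).pow (by rw [hs]; exact pow_pos hp.pos _) ?_⟩
    rw [hs, pow_succ]

/-- Let `k` be a field with a normalized discrete valuation `v`, `p` a
prime with `char k ≠ p`, `a ∈ k^×` with `p ∤ v(a)`, and `r, m ≥ 1`. If `α` is a root of
`x^(p^m) - a` (so `L = k(α)`), then every `p^r`-th root of unity contained in `k(α)`
already lies in `k`. -/
theorem stmt3 {k : Type*} [Field k] (v : k → ℤ) (hv : IsNormalizedDiscreteValuation v)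
    (p : ℕ) (hp : p.Prime) (hchar : ringChar k ≠ p)
    (a : k) (ha : a ≠ 0) (hva : ¬ (p : ℤ) ∣ v a)
    (r m : ℕ) (hr : 1 ≤ r) (hm : 1 ≤ m)
    (L : Type*) [Field L] [Algebra k L] (α : L)
    (hα : α ^ p ^ m = algebraMap k L a) (hgen : adjoin k {α} = ⊤) :
    ∀ ζ : L, ζ ^ p ^ r = 1 → ∃ c : k, algebraMap k L c = ζ := by
  have hpa (b c : k) (j : ℕ) (hc : v (c ^ j) = 0) : a ≠ b ^ p * c ^ j := by
    rintro rfl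
    exact hva (hv.dvd_map_pow_mul ha hc)
  have hroot (ω : L) (hω : IsPrimitiveRoot ω p) : ∃ ω' : k, algebraMap k L ω' = ω := by
    by_cases hp2 : p = 2
    · subst hp2
      exact ⟨-1, by rw [map_neg, map_one, hω.eq_neg_one_of_two_right]⟩
    · refine hω.mem_range_algebraMap_of_radical hp hp2 hα hgen fun b hb ↦ ?_
      exact hpa b 1 0 (by simpa using hv.map_one) (by simp [hb])
  clear hr
  intro ζ
  induction r generalizing ζ with
  | zero => exact fun h ↦ ⟨1, by simpa using h.symm⟩
  | succ r ih =>
    intro hζ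
    by_cases h1 : ζ ^ p = 1
    · have : Fact p.Prime := ⟨hp⟩
      by_cases hζ1 : ζ = 1
      · exact ⟨1, by simp [hζ1]⟩
      · exact hroot ζ (IsPrimitiveRoot.iff_orderOf.2 (orderOf_eq_prime_iff.2 ⟨h1, hζ1⟩))
    have hζr : (ζ ^ p) ^ p ^ r = 1 := by rw [← pow_mul, ← pow_succ', hζ]
    obtain ⟨t, ht⟩ := exists_isPrimitiveRoot_pow_of_pow_prime_pow_eq_one hp hζr h1
    obtain ⟨ω, hω⟩ := hroot _ ht
    rw [← hω] at ht
    have hωk := ht.of_map_of_injective (algebraMap k L).injective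
    obtain ⟨c, hc⟩ := ih (ζ ^ p) hζr
    have hcr : c ^ p ^ r = 1 := (algebraMap k L).injective (by rw [map_pow, hc, hζr, map_one])
    have hc0 : c ≠ 0 := by
      rintro rfl
      simp [hp.ne_zero] at hcr
    have hvc (j : ℕ) : v (c ^ j) = 0 := by
      rw [hv.map_pow hc0, hv.map_eq_zero_of_pow_eq_one (pow_ne_zero _ hp.ne_zero) hcr, mul_zero]
    refine mem_range_algebraMap_of_pow_eq hp hωk hα hgen hc0 hc.symm
      (fun b j ↦ hpa b c j (hvc j)) fun hp2 ↦ ?_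
    subst hp2
    refine ⟨AdjoinSimple.gen k ζ ^ 2 ^ t, Subtype.ext ?_⟩
    have h2 := ht.eq_neg_one_of_two_right
    rw [hω] at h2
    simpa [← pow_mul, mul_comm] using h2
end

section
/- Let k be a field with a normalized discrete valuation v, let p be a prime number with char k ≠ p, let a ∈ k^×, and let m ≥ 1. If p does not divide v(a), then the polynomial x^{p^m} − a is irreducible in k[x], and for any root α of this polynomial the intermediate fields of the extension k(α)/k are linearly ordered by inclusion. -/
open Polynomial IntermediateField

section LogarithmicMap

variable {k : Type*} [Field k] {v : k → ℤ}
  (hv : ∀ x y : k, x ≠ 0 → y ≠ 0 → v (x * y) = v x + v y)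

include hv

theorem map_one_of_map_mul_eq_add : v 1 = 0 := by
  have := hv 1 1 one_ne_zero one_ne_zero
  rw [mul_one] at this
  omega

theorem map_pow_of_map_mul_eq_add {x : k} (hx : x ≠ 0) (n : ℕ) : v (x ^ n) = n * v x := by
  induction n with
  | zero => simp [map_one_of_map_mul_eq_add hv]
  | succ n ih =>
    rw [pow_succ, hv _ _ (pow_ne_zero n hx) hx, ih]
    push_cast
    ring

/-- If `p ∤ v(a)`, then every finite extension in which `a` has a `p ^ m`-th root has degree
divisible by `p ^ m`. -/
theorem prime_pow_dvd_finrank {p : ℕ} (hp : p.Prime) {a : k} (ha : a ≠ 0)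
    (hva : ¬ (p : ℤ) ∣ v a) {m : ℕ} {L : Type*} [Field L] [Algebra k L] [FiniteDimensional k L]
    {α : L} (hα : α ^ p ^ m = algebraMap k L a) : p ^ m ∣ Module.finrank k L := by
  have hN : Algebra.norm k α ^ p ^ m = a ^ Module.finrank k L := by
    rw [← map_pow, hα, Algebra.norm_algebraMap]
  have hN0 : Algebra.norm k α ≠ 0 := by
    intro h
    rw [h, zero_pow (pow_ne_zero m hp.ne_zero)] at hN
    exact pow_ne_zero _ ha hN.symm
  have h := congrArg v hN
  rw [map_pow_of_map_mul_eq_add hv hN0, map_pow_of_map_mul_eq_add hv ha] at h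
  have hcop : IsCoprime ((p ^ m : ℕ) : ℤ) (v a) := by
    push_cast
    exact ((Nat.prime_iff_prime_int.mp hp).coprime_iff_not_dvd.mpr hva).pow_left
  exact Int.natCast_dvd_natCast.mp (hcop.dvd_of_dvd_mul_right (Dvd.intro _ h))

theorem irreducible_X_pow_prime_pow_sub_C {p : ℕ} (hp : p.Prime) {a : k} (ha : a ≠ 0)
    (hva : ¬ (p : ℤ) ∣ v a) (m : ℕ) : Irreducible (X ^ p ^ m - C a) := by
  have hpos : 0 < p ^ m := pow_pos hp.pos m
  obtain ⟨g, hg, hdvd⟩ := exists_irreducible_of_natDegree_ne_zero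
    (f := X ^ p ^ m - C a) (by rw [natDegree_X_pow_sub_C]; exact hpos.ne')
  have := Fact.mk hg
  have : FiniteDimensional k (AdjoinRoot g) := (AdjoinRoot.powerBasis hg.ne_zero).finite
  have hroot : AdjoinRoot.root g ^ p ^ m = algebraMap k (AdjoinRoot g) a := by
    have h := AdjoinRoot.mk_eq_zero.mpr hdvd
    rw [map_sub, map_pow, AdjoinRoot.mk_X, AdjoinRoot.mk_C, sub_eq_zero] at h
    exact h
  have hdeg := prime_pow_dvd_finrank hv hp ha hva hroot
  rw [(AdjoinRoot.powerBasis hg.ne_zero).finrank, AdjoinRoot.powerBasis_dim] at hdeg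
  refine (associated_of_dvd_of_natDegree_le hdvd (X_pow_sub_C_ne_zero hpos a) ?_).irreducible hg
  rw [natDegree_X_pow_sub_C]
  exact Nat.le_of_dvd hg.natDegree_pos hdeg

theorem minpoly_eq_X_pow_prime_pow_sub_C {p : ℕ} (hp : p.Prime) {a : k} (ha : a ≠ 0)
    (hva : ¬ (p : ℤ) ∣ v a) {m : ℕ} {L : Type*} [Field L] [Algebra k L] {α : L}
    (hα : α ^ p ^ m = algebraMap k L a) : minpoly k α = X ^ p ^ m - C a :=
  (minpoly.eq_of_irreducible_of_monic (irreducible_X_pow_prime_pow_sub_C hv hp ha hva m)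
    (by simp [hα]) (monic_X_pow_sub_C a (pow_ne_zero m hp.ne_zero))).symm

theorem finrank_adjoin_eq_prime_pow {p : ℕ} (hp : p.Prime) {a : k} (ha : a ≠ 0)
    (hva : ¬ (p : ℤ) ∣ v a) {m : ℕ} {L : Type*} [Field L] [Algebra k L] {α : L}
    (hα : α ^ p ^ m = algebraMap k L a) : Module.finrank k k⟮α⟯ = p ^ m := by
  have hint : IsIntegral k α := .of_pow (pow_pos hp.pos m) (hα ▸ isIntegral_algebraMap)
  rw [adjoin.finrank hint, minpoly_eq_X_pow_prime_pow_sub_C hv hp ha hva hα,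
    natDegree_X_pow_sub_C]

theorem trace_eq_zero_of_pow_prime {p : ℕ} (hp : p.Prime) {a : k} (ha : a ≠ 0)
    (hva : ¬ (p : ℤ) ∣ v a) {L : Type*} [Field L] [Algebra k L] [FiniteDimensional k L] {α : L}
    (hα : α ^ p = algebraMap k L a) : Algebra.trace k L α = 0 := by
  have hmin := minpoly_eq_X_pow_prime_pow_sub_C hv hp ha hva (m := 1) (by rwa [pow_one])
  rw [pow_one] at hmin
  have hp2 := hp.two_le
  rw [trace_eq_finrank_mul_minpoly_nextCoeff, hmin, nextCoeff_of_natDegree_pos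
    (by rw [natDegree_X_pow_sub_C]; exact hp.pos), natDegree_X_pow_sub_C, coeff_sub, coeff_X_pow,
    coeff_C, if_neg (by omega), if_neg (by omega)]
  simp

theorem map_eq_zero_of_pow_eq_one {x : k} {n : ℕ} (hn : n ≠ 0) (hx : x ^ n = 1) : v x = 0 := by
  have hx0 : x ≠ 0 := by
    rintro rfl
    simp [hn] at hx
  have h := map_pow_of_map_mul_eq_add hv hx0 n
  rw [hx, map_one_of_map_mul_eq_add hv, eq_comm, mul_eq_zero] at h
  exact h.resolve_left (by exact_mod_cast hn)

/-- An extension generated by a `p`-th root of an element `a` with `p ∤ v(a)`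
contains no new roots of unity of `p`-power order. -/
theorem mem_range_of_pow_eq_one_of_adjoin_prime_root {p : ℕ} (hp : p.Prime) (hpk : (p : k) ≠ 0)
    {a : k} (ha : a ≠ 0) (hva : ¬ (p : ℤ) ∣ v a) {L : Type*} [Field L] [Algebra k L] {α : L}
    (hα : α ^ p = algebraMap k L a) (htop : k⟮α⟯ = ⊤) {n : ℕ} {ζ : L} (hζ : ζ ^ p ^ n = 1) :
    ζ ∈ Set.range (algebraMap k L) := by
  have hα0 : α ≠ 0 := by
    rintro rfl
    rw [zero_pow hp.ne_zero, eq_comm, map_eq_zero] at hα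
    exact ha hα
  have hrank : Module.finrank k L = p := by
    have h := finrank_adjoin_eq_prime_pow hv hp ha hva (m := 1) (α := α) (by rwa [pow_one])
    rwa [htop, finrank_top', pow_one] at h
  have : FiniteDimensional k L := .of_finrank_pos (hrank ▸ hp.pos)
  have := isSimpleOrder_of_finrank_prime k L (hrank ▸ hp)
  induction n generalizing ζ with
  | zero => exact ⟨1, by simpa using hζ.symm⟩
  | succ n ih =>
    obtain ⟨c, hc⟩ := ih (ζ := ζ ^ p) (by rw [← pow_mul, ← pow_succ', hζ])
    have hc1 : c ^ p ^ n = 1 := by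
      apply (algebraMap k L).injective
      rw [map_pow, hc, ← pow_mul, ← pow_succ', hζ, map_one]
    have hpn := pow_ne_zero n hp.ne_zero
    have hc0 : c ≠ 0 := by
      rintro rfl
      exact zero_ne_one ((zero_pow hpn).symm.trans hc1)
    by_contra hmem
    have hadj : Algebra.adjoin k {ζ} = ⊤ := by
      rw [← adjoin_simple_toSubalgebra_of_isAlgebraic (IsAlgebraic.of_finite k ζ)]
      have h := (eq_bot_or_eq_top k⟮ζ⟯).resolve_left fun h ↦
        hmem (mem_bot.mp (adjoin_simple_eq_bot_iff.mp h))
      rw [h, top_toSubalgebra]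
    have htr (j : ℕ) : Algebra.trace k L (α * ζ ^ j) = 0 := by
      refine trace_eq_zero_of_pow_prime hv hp (a := a * c ^ j) (mul_ne_zero ha (pow_ne_zero j hc0))
        ?_ ?_
      · rwa [hv _ _ ha (pow_ne_zero j hc0), map_pow_of_map_mul_eq_add hv hc0,
          map_eq_zero_of_pow_eq_one hv hpn hc1, mul_zero, add_zero]
      · rw [mul_pow, hα, map_mul, map_pow, hc, ← pow_mul, ← pow_mul, mul_comm j]
    have htr' (f : k[X]) : Algebra.trace k L (α * aeval ζ f) = 0 := by
      induction f using Polynomial.induction_on' with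
      | add f g hf hg => rw [map_add, mul_add, map_add, hf, hg, add_zero]
      | monomial j r =>
        rw [aeval_monomial, mul_left_comm, ← Algebra.smul_def, map_smul, htr, smul_zero]
    have hinv : α⁻¹ ∈ Algebra.adjoin k {ζ} := hadj ▸ Algebra.mem_top
    rw [Algebra.adjoin_singleton_eq_range_aeval] at hinv
    obtain ⟨f, hf⟩ := hinv
    have h := htr' f
    have hf' : aeval ζ f = α⁻¹ := hf
    rw [hf', mul_inv_cancel₀ hα0, ← map_one (algebraMap k L), Algebra.trace_algebraMap, hrank,
      nsmul_one] at h
    exact hpk h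

/-- If `p ∤ v(a)`, then adjoining a `p ^ m`-th root of `a` adds no new roots of unity of
`p`-power order. -/
theorem mem_range_of_pow_eq_one_of_adjoin_prime_pow_root {p : ℕ} (hp : p.Prime)
    (hpk : (p : k) ≠ 0) {a : k} (ha : a ≠ 0) (hva : ¬ (p : ℤ) ∣ v a) {m : ℕ} {L : Type*} [Field L]
    [Algebra k L] {α : L} (hα : α ^ p ^ m = algebraMap k L a) (htop : k⟮α⟯ = ⊤) {n : ℕ} {ζ : L}
    (hζ : ζ ^ p ^ n = 1) : ζ ∈ Set.range (algebraMap k L) := by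
  induction m generalizing L with
  | zero =>
    rw [pow_zero, pow_one] at hα
    have hbot : k⟮α⟯ = ⊥ := adjoin_simple_eq_bot_iff.mpr (mem_bot.mpr ⟨a, hα.symm⟩)
    exact mem_bot.mp (hbot ▸ htop ▸ mem_top)
  | succ m ih =>
    have hb : (α ^ p) ^ p ^ m = algebraMap k L a := by rw [← pow_mul, ← pow_succ', hα]
    let b : k⟮α ^ p⟯ := AdjoinSimple.gen k (α ^ p)
    have hb' : b ^ p ^ m = algebraMap k k⟮α ^ p⟯ a := Subtype.ext hb
    have hpm : p ^ m ≠ 0 := pow_ne_zero m hp.ne_zero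
    have hrank := finrank_adjoin_eq_prime_pow hv hp ha hva hb
    have : FiniteDimensional k k⟮α ^ p⟯ := .of_finrank_pos (hrank ▸ Nat.pos_of_ne_zero hpm)
    have hb0 : b ≠ 0 := by
      intro h
      rw [h, zero_pow hpm, eq_comm, map_eq_zero] at hb'
      exact ha hb'
    have hvb : v (Algebra.norm k b) = v a := by
      have h := congrArg (fun x ↦ v (Algebra.norm k x)) hb'
      simp only [map_pow, Algebra.norm_algebraMap, hrank] at h
      rw [map_pow_of_map_mul_eq_add hv (Algebra.norm_ne_zero_iff.mpr hb0),
        map_pow_of_map_mul_eq_add hv ha] at h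
      exact mul_left_cancel₀ (by exact_mod_cast hpm) h
    have htop' : (k⟮α ^ p⟯)⟮α⟯ = ⊤ := by
      rw [← restrictScalars_eq_top_iff (K := k), eq_top_iff, ← htop, adjoin_simple_le_iff]
      exact mem_adjoin_simple_self _ α
    obtain ⟨ξ, rfl⟩ := mem_range_of_pow_eq_one_of_adjoin_prime_root
      (v := fun x : k⟮α ^ p⟯ ↦ v (Algebra.norm k x))
      (fun x y hx hy ↦ by
        rw [map_mul, hv _ _ (Algebra.norm_ne_zero_iff.mpr hx) (Algebra.norm_ne_zero_iff.mpr hy)])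
      hp (fun h ↦ hpk ((algebraMap k k⟮α ^ p⟯).injective (by simpa using h)))
      hb0 (by rwa [hvb]) (α := α) rfl htop' hζ
    have hξ : ξ ^ p ^ n = 1 := (algebraMap k⟮α ^ p⟯ L).injective (by rw [map_pow, hζ, map_one])
    have hgen : k⟮b⟯ = ⊤ :=
      lift_injective _ ((lift_adjoin_simple k _ b).trans (lift_top k k⟮α ^ p⟯).symm)
    obtain ⟨c, rfl⟩ := ih hb' hgen hξ
    exact ⟨c, IsScalarTower.algebraMap_apply k k⟮α ^ p⟯ L c⟩

/-- Every intermediate field of `k(α)/k`, where `α ^ p ^ m = a` and `p ∤ v(a)`, is generated by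
the power of `α` whose exponent is the codegree. -/
theorem eq_adjoin_pow_finrank {p : ℕ} (hp : p.Prime) (hpk : (p : k) ≠ 0) {a : k} (ha : a ≠ 0)
    (hva : ¬ (p : ℤ) ∣ v a) {m : ℕ} {L : Type*} [Field L] [Algebra k L] [FiniteDimensional k L]
    {α : L} (hα : α ^ p ^ m = algebraMap k L a) (htop : k⟮α⟯ = ⊤) (E : IntermediateField k L) :
    E = k⟮α ^ Module.finrank E L⟯ := by
  have hα0 : α ≠ 0 := by
    rintro rfl
    rw [zero_pow (pow_ne_zero m hp.ne_zero), eq_comm, map_eq_zero] at hα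
    exact ha hα
  set d := Module.finrank E L with hd
  have hd0 : 0 < d := Module.finrank_pos
  have hN : (algebraMap E L (Algebra.norm E α)) ^ p ^ m = (α ^ d) ^ p ^ m := by
    have hα' : α ^ p ^ m = algebraMap E L (algebraMap k E a) := hα
    rw [← map_pow, ← map_pow, hα', Algebra.norm_algebraMap, map_pow, ← hα', ← hd, ← pow_mul,
      ← pow_mul, mul_comm]
  obtain ⟨c, hc⟩ := mem_range_of_pow_eq_one_of_adjoin_prime_pow_root hv hp hpk ha hva hα htop
    (n := m) (ζ := α ^ d / algebraMap E L (Algebra.norm E α)) (by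
      rw [div_pow, hN, div_self (pow_ne_zero _ (pow_ne_zero _ hα0))])
  have hN0 : algebraMap E L (Algebra.norm E α) ≠ 0 := by
    simpa using hα0
  have hmem : α ^ d ∈ E := by
    rw [← div_mul_cancel₀ (α ^ d) hN0, ← hc]
    exact mul_mem (E.algebraMap_mem c) (Algebra.norm E α).2
  have hle : k⟮α ^ d⟯ ≤ E := adjoin_simple_le_iff.mpr hmem
  refine (eq_of_le_of_finrank_le' hle ?_).symm
  have htop' : (k⟮α ^ d⟯)⟮α⟯ = ⊤ := by
    rw [← restrictScalars_eq_top_iff (K := k), eq_top_iff, ← htop, adjoin_simple_le_iff]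
    exact mem_adjoin_simple_self _ α
  rw [← finrank_top', ← htop', adjoin.finrank (IsIntegral.of_finite _ α)]
  have hroot : aeval α (X ^ d - C (AdjoinSimple.gen k (α ^ d))) = 0 := by
    rw [map_sub, map_pow, aeval_X, aeval_C, AdjoinSimple.algebraMap_gen, sub_self]
  exact (natDegree_le_of_dvd (minpoly.dvd _ _ hroot) (X_pow_sub_C_ne_zero hd0 _)).trans_eq
    natDegree_X_pow_sub_C

end LogarithmicMap

/-- Let `k` be a field with a normalized discrete valuation `v`, `p` a
prime with `char k ≠ p`, `a ∈ k^×`, and `m ≥ 1`. If `p ∤ v(a)`, then `x^(p^m) - a` is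
irreducible in `k[x]`, and for any root `α` of this polynomial the intermediate fields of
`k(α)/k` are linearly ordered by inclusion. -/
theorem stmt4 {k : Type*} [Field k] (v : k → ℤ) (hv : IsNormalizedDiscreteValuation v)
    (p : ℕ) (hp : p.Prime) (hchar : ringChar k ≠ p)
    (a : k) (ha : a ≠ 0) (hva : ¬ (p : ℤ) ∣ v a) (m : ℕ) (hm : 1 ≤ m) :
    Irreducible (X ^ p ^ m - C a) ∧
      ∀ (L : Type*) [Field L] [Algebra k L] (α : L),
        α ^ p ^ m = algebraMap k L a → adjoin k {α} = ⊤ →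
        ∀ E F : IntermediateField k L, E ≤ F ∨ F ≤ E := by
  refine ⟨irreducible_X_pow_prime_pow_sub_C hv.map_mul hp ha hva m, ?_⟩
  intro L _ _ α hα htop E F
  have hpk : (p : k) ≠ 0 := by
    intro h
    exact ((Nat.dvd_prime hp).mp ((ringChar.spec k p).mp h)).elim
      (fun h1 ↦ CharP.ringChar_ne_one h1) hchar
  have hrank : Module.finrank k L = p ^ m := by
    have h := finrank_adjoin_eq_prime_pow hv.map_mul hp ha hva hα
    rwa [htop, finrank_top'] at h
  have : FiniteDimensional k L := .of_finrank_pos (hrank ▸ pow_pos hp.pos m)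
  have hpow (K : IntermediateField k L) : ∃ i, Module.finrank K L = p ^ i := by
    obtain ⟨i, -, hi⟩ := (Nat.dvd_prime_pow hp).mp
      (hrank ▸ Dvd.intro_left _ (Module.finrank_mul_finrank k K L))
    exact ⟨i, hi⟩
  have hle {K M : IntermediateField k L} (h : Module.finrank M L ∣ Module.finrank K L) :
      K ≤ M := by
    rw [eq_adjoin_pow_finrank hv.map_mul hp hpk ha hva hα htop K, adjoin_simple_le_iff]
    obtain ⟨e, he⟩ := h
    rw [he, pow_mul]
    refine pow_mem ?_ e
    have hM := mem_adjoin_simple_self k (α ^ Module.finrank M L)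
    rwa [← eq_adjoin_pow_finrank hv.map_mul hp hpk ha hva hα htop M] at hM
  obtain ⟨i, hi⟩ := hpow E
  obtain ⟨j, hj⟩ := hpow F
  rcases le_total i j with hij | hij
  · exact .inr (hle (hi ▸ hj ▸ pow_dvd_pow p hij))
  · exact .inl (hle (hi ▸ hj ▸ pow_dvd_pow p hij))
end

section
/- Let k be a field with char k = p > 0, and let K/k be a nontrivial cyclic extension of p-power degree. Let k'/k be any field extension such that K and k' are subfields of a common overfield, and suppose that K' = Kk' is a nontrivial extension of k' (i.e. K ⊄ k'). Then there exists a field extension L ⊇ K with [L:K] = p such that L/k is cyclic; and for any such L, the compositum LK' is cyclic over k' with [LK' : K'] = p. -/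
universe u

open IntermediateField Polynomial

theorem exists_sub_eq_of_trace_eq_zero {F K : Type*} [Field F] [Field K] [Algebra F K]
    [FiniteDimensional F K] [IsGalois F K] {σ : K ≃ₐ[F] K} (hσ : ∀ τ, τ ∈ Subgroup.zpowers σ)
    {x : K} (hx : Algebra.trace F K x = 0) : ∃ y, σ y - y = x := by
  set f : K →ₗ[F] K := σ.toLinearMap - LinearMap.id
  have hker : LinearMap.ker f = (1 : Submodule F K) := by
    ext y
    rw [LinearMap.mem_ker, Submodule.mem_one]
    change σ y - y = 0 ↔ y ∈ Set.range (algebraMap F K)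
    rw [IsGalois.mem_range_algebraMap_iff_fixed, sub_eq_zero]
    refine ⟨fun h τ ↦ ?_, fun h ↦ h σ⟩
    have : Subgroup.zpowers σ ≤ MulAction.stabilizer (K ≃ₐ[F] K) y := by
      rw [Subgroup.zpowers_le]
      exact h
    exact this (hσ τ)
  have hle : LinearMap.range f ≤ LinearMap.ker (Algebra.trace F K) := by
    rintro _ ⟨y, rfl⟩
    rw [LinearMap.mem_ker]
    change Algebra.trace F K (σ y - y) = 0
    rw [map_sub, Algebra.trace_eq_of_algEquiv, sub_self]
  have h1 := f.finrank_range_add_finrank_ker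
  have h2 := (Algebra.trace F K).finrank_range_add_finrank_ker
  rw [LinearMap.range_eq_top.2 (Algebra.trace_surjective F K), finrank_top,
    Module.finrank_self] at h2
  have h3 : Module.finrank F (1 : Submodule F K) = 1 := by
    rw [Submodule.one_eq_span, finrank_span_singleton one_ne_zero]
  rw [hker, h3] at h1
  have hx' : x ∈ LinearMap.ker (Algebra.trace F K) := hx
  rw [← Submodule.eq_of_le_of_finrank_eq hle (by lia)] at hx'
  exact hx'

theorem irreducible_X_pow_sub_X_sub_C {K : Type*} [Field K] (p : ℕ) [Fact p.Prime] [CharP K p]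
    {a : K} (ha : ∀ c : K, c ^ p - c ≠ a) : Irreducible (X ^ p - X - C a : K[X]) := by
  have hp : 1 < p := (Fact.out : p.Prime).one_lt
  have hlt : (X + C a : K[X]).degree < p := by
    rw [degree_X_add_C]
    exact_mod_cast hp
  have hmonic : (X ^ p - X - C a : K[X]).Monic := by
    rw [sub_sub]
    exact monic_X_pow_sub hlt
  have hdeg : (X ^ p - X - C a : K[X]).natDegree = p := by
    rw [sub_sub]
    rw [natDegree_sub_eq_left_of_natDegree_lt] <;> simp [hp]
  rw [hmonic.irreducible_iff_natDegree']
  refine ⟨fun h ↦ ?_, fun f g _ hg hfg hmem ↦ ?_⟩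
  · rw [h, natDegree_one] at hdeg
    lia
  rw [hdeg, Finset.mem_Ioc] at hmem
  let E := AlgebraicClosure K
  have : CharP E p := charP_of_injective_algebraMap (algebraMap K E).injective p
  let S : Subfield E := (algebraMap K E).fieldRange
  have hroot : ∀ r ∈ (g.map (algebraMap K E)).roots, r ^ p - r = algebraMap K E a := by
    intro r hr
    have hr' : eval r (g.map (algebraMap K E)) = 0 := (mem_roots'.1 hr).2
    have h := congrArg (fun q ↦ eval r (q.map (algebraMap K E))) hfg
    simp only [Polynomial.map_mul, eval_mul, hr', mul_zero] at h
    simpa [sub_eq_zero] using h.symm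
  have hsplits : (g.map (algebraMap K E)).Splits := IsAlgClosed.splits _
  have hcard := hsplits.natDegree_eq_card_roots
  rw [natDegree_map] at hcard
  obtain ⟨t, ht⟩ := Multiset.card_pos_iff_exists_mem.1 (hcard ▸ hmem.1)
  have hdiff : ((g.map (algebraMap K E)).roots.map fun r ↦ r - t).sum ∈ S := by
    refine S.multiset_sum_mem _ fun x hx ↦ ?_
    obtain ⟨r, hr, rfl⟩ := Multiset.mem_map.1 hx
    refine (bot_le : (⊥ : Subfield E) ≤ S) ((Subfield.mem_bot_iff_pow_eq_self E p).2 ?_)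
    rw [sub_pow_char]
    linear_combination hroot r hr - hroot t ht
  rw [Multiset.sum_map_sub, Multiset.map_id', Multiset.map_const', Multiset.sum_replicate,
    ← hcard] at hdiff
  have hsum : (g.map (algebraMap K E)).roots.sum ∈ S := by
    have h := hsplits.nextCoeff_eq_neg_sum_roots_of_monic (hg.map _)
    rw [nextCoeff_map (algebraMap K E).injective, eq_neg_iff_add_eq_zero, add_comm,
      ← eq_neg_iff_add_eq_zero] at h
    exact h ▸ S.neg_mem ⟨_, rfl⟩
  have hd : (g.natDegree : E) ≠ 0 := by
    rw [Ne, CharP.cast_eq_zero_iff E p]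
    exact fun h ↦ (Nat.le_of_dvd hmem.1 h).not_gt (by lia)
  obtain ⟨c, hc⟩ : t ∈ S := by
    have h := S.sub_mem hsum hdiff
    rw [sub_sub_cancel, nsmul_eq_mul] at h
    rw [← inv_mul_cancel_left₀ hd t]
    exact S.mul_mem (S.inv_mem (natCast_mem S _)) h
  refine ha c ((algebraMap K E).injective ?_)
  rw [map_sub, map_pow, hc, hroot t ht]

theorem sum_range_pow_apply_eq_trace {F K : Type*} [Field F] [Field K] [Algebra F K]
    [FiniteDimensional F K] [IsGalois F K] {σ : K ≃ₐ[F] K} (hσ : ∀ τ, τ ∈ Subgroup.zpowers σ)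
    (x : K) :
    ∑ i ∈ Finset.range (orderOf σ), (σ ^ i) x = algebraMap F K (Algebra.trace F K x) := by
  classical
  rw [trace_eq_sum_automorphisms, ← IsCyclic.image_range_orderOf hσ, Finset.sum_image]
  exact fun i hi j hj h ↦ pow_injOn_Iio_orderOf (by simpa using hi) (by simpa using hj) h

theorem exists_isCyclic_extension {k K : Type u} [Field k] [Field K] [Algebra k K] (p : ℕ)
    [Fact p.Prime] [CharP k p] [IsGalois k K] [IsCyclic (K ≃ₐ[k] K)] {e : ℕ}
    (hdeg : Module.finrank k K = p ^ (e + 1)) :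
    ∃ (L : Type u) (_ : Field L) (_ : Algebra k L) (_ : Algebra K L) (_ : IsScalarTower k K L),
      Module.finrank K L = p ∧ IsGalois k L ∧ IsCyclic (L ≃ₐ[k] L) := by
  have hp : p.Prime := Fact.out
  have : FiniteDimensional k K :=
    Module.finite_of_finrank_pos (hdeg ▸ pow_pos hp.pos _)
  have : CharP K p := charP_of_injective_algebraMap (algebraMap k K).injective p
  obtain ⟨σ, hσ⟩ := IsCyclic.exists_generator (α := K ≃ₐ[k] K)
  have hord : orderOf σ = p ^ (e + 1) := by
    rw [orderOf_eq_card_of_forall_mem_zpowers hσ, IsGalois.card_aut_eq_finrank, hdeg]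
  have hsum := sum_range_pow_apply_eq_trace hσ
  obtain ⟨b, hb⟩ := Algebra.trace_surjective k K 1
  have htr : Algebra.trace k K (b ^ p - b) = 0 := by
    apply (algebraMap k K).injective
    rw [map_sub, map_sub, ← hsum, hb]
    simp only [map_pow]
    rw [← sum_pow_char, hsum, hb]
    simp
  obtain ⟨a, ha⟩ := exists_sub_eq_of_trace_eq_zero hσ htr
  have hirr : Irreducible (X ^ p - X - C a : K[X]) := by
    refine irreducible_X_pow_sub_X_sub_C p fun c hc ↦ ?_
    obtain ⟨d, hd⟩ : σ c - c - b ∈ (algebraMap k K).fieldRange := by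
      refine (bot_le : (⊥ : Subfield K) ≤ _) ((Subfield.mem_bot_iff_pow_eq_self K p).2 ?_)
      have hσc := congrArg σ hc
      rw [map_sub, map_pow] at hσc
      rw [sub_pow_char, sub_pow_char]
      linear_combination hσc - hc + ha
    have h := congrArg (Algebra.trace k K) hd
    rw [Algebra.trace_algebraMap, map_sub, map_sub, Algebra.trace_eq_of_algEquiv, hb, hdeg] at h
    simp at h
  have := Fact.mk hirr
  let f : K[X] := X ^ p - X - C a
  have hf : f.natDegree = p := by
    change (X ^ p - X - C a : K[X]).natDegree = p
    rw [sub_sub, natDegree_sub_eq_left_of_natDegree_lt] <;> simp [hp.one_lt]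
  let pb := AdjoinRoot.powerBasis hirr.ne_zero
  have hfin : Module.finrank K (AdjoinRoot f) = p := pb.finrank.trans hf
  have : FiniteDimensional K (AdjoinRoot f) := pb.finite
  have : FiniteDimensional k (AdjoinRoot f) := FiniteDimensional.trans k K (AdjoinRoot f)
  have : CharP (AdjoinRoot f) p :=
    charP_of_injective_algebraMap (algebraMap k (AdjoinRoot f)).injective p
  have hroot : AdjoinRoot.root f ^ p - AdjoinRoot.root f = AdjoinRoot.of f a := by
    have h := AdjoinRoot.eval₂_root f
    simpa [f, sub_eq_zero] using h
  obtain ⟨s, hsof, hsroot⟩ : ∃ s : AdjoinRoot f →ₐ[k] AdjoinRoot f,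
      (∀ x, s (AdjoinRoot.of f x) = AdjoinRoot.of f (σ x)) ∧
        s (AdjoinRoot.root f) = AdjoinRoot.root f + AdjoinRoot.of f b := by
    refine ⟨AdjoinRoot.liftAlgHom f ((IsScalarTower.toAlgHom k K (AdjoinRoot f)).comp σ.toAlgHom)
      (AdjoinRoot.root f + AdjoinRoot.of f b) ?_, fun x ↦ AdjoinRoot.liftAlgHom_of _ _ _ _ _,
      AdjoinRoot.liftAlgHom_root _ _ _ _⟩
    have hab : AdjoinRoot.of f (σ a) = AdjoinRoot.of f (a + b ^ p - b) := by
      rw [eq_add_of_sub_eq ha]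
      ring_nf
    rw [map_sub, map_add, map_pow] at hab
    simp only [f, eval₂_sub, eval₂_X_pow, eval₂_X, eval₂_C, add_pow_char]
    change _ - AdjoinRoot.of f (σ a) = 0
    linear_combination hroot - hab
  let S : AdjoinRoot f ≃ₐ[k] AdjoinRoot f := AlgEquiv.ofBijective s s.bijective
  have hSof (n : ℕ) (x : K) : (S ^ n) (AdjoinRoot.of f x) = AdjoinRoot.of f ((σ ^ n) x) := by
    induction n generalizing x with
    | zero => rfl
    | succ n ih =>
      rw [pow_succ, pow_succ, AlgEquiv.mul_apply, AlgEquiv.mul_apply, ← ih]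
      congr 1
      exact hsof x
  have hSroot (n : ℕ) : (S ^ n) (AdjoinRoot.root f) =
      AdjoinRoot.root f + AdjoinRoot.of f (∑ i ∈ Finset.range n, (σ ^ i) b) := by
    induction n with
    | zero => simp
    | succ n ih =>
      have h : S (AdjoinRoot.root f) = AdjoinRoot.root f + AdjoinRoot.of f b :=
        hsroot
      rw [pow_succ, AlgEquiv.mul_apply, h, map_add, ih, hSof, Finset.sum_range_succ, map_add,
        add_assoc]
  have hT : (S ^ p ^ (e + 1)) (AdjoinRoot.root f) = AdjoinRoot.root f + 1 := by
    rw [hSroot, ← hord, hsum, hb, map_one, map_one]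
  have hTn (n : ℕ) : ((S ^ p ^ (e + 1)) ^ n) (AdjoinRoot.root f) = AdjoinRoot.root f + n := by
    induction n with
    | zero => simp
    | succ n ih => rw [pow_succ, AlgEquiv.mul_apply, hT, map_add, ih, map_one]; push_cast; ring
  have hSord : orderOf S = p ^ (e + 1 + 1) := by
    refine orderOf_eq_prime_pow (fun h ↦ ?_) ?_
    · rw [h] at hT
      simp at hT
    · have h : ((S ^ p ^ (e + 1 + 1)).toRingEquiv : AdjoinRoot f →+* AdjoinRoot f) =
          RingHom.id _ := by
        refine AdjoinRoot.ringHom_ext ?_ ?_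
        · ext x
          change (S ^ p ^ (e + 1 + 1)) (AdjoinRoot.of f x) = AdjoinRoot.of f x
          rw [hSof, pow_succ p, pow_mul, ← hord, pow_orderOf_eq_one, one_pow]
          rfl
        · change (S ^ p ^ (e + 1 + 1)) (AdjoinRoot.root f) = AdjoinRoot.root f
          rw [pow_succ p, pow_mul, hTn, CharP.cast_eq_zero, add_zero]
      exact AlgEquiv.ext fun x ↦ RingHom.congr_fun h x
  have hk : Module.finrank k (AdjoinRoot f) = p ^ (e + 1 + 1) := by
    rw [← Module.finrank_mul_finrank k K, hdeg, hfin, ← pow_succ]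
  have hcard : Nat.card (AdjoinRoot f ≃ₐ[k] AdjoinRoot f) = p ^ (e + 1 + 1) := by
    apply le_antisymm
    · rw [← hk, Nat.card_eq_fintype_card]
      exact AlgEquiv.card_le
    · rw [← hSord]
      exact orderOf_le_card
  exact ⟨AdjoinRoot f, inferInstance, inferInstance, inferInstance, inferInstance, hfin,
    .of_card_aut_eq_finrank _ _ (hcard.trans hk.symm),
    isCyclic_of_orderOf_eq_card S (hSord.trans hcard.symm)⟩

theorem finiteDimensional_and_isGalois_of_adjoin_range_eq_top (F : Type*) {K L E : Type*}
    [Field F] [Field K] [Field L] [Field E] [Algebra F K] [Algebra F L] [Algebra F E] [Algebra K E]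
    [Algebra L E] [IsScalarTower F K E] [IsScalarTower F L E] [IsGalois F K] [FiniteDimensional F K]
    (h : adjoin L (Set.range (algebraMap K E)) = ⊤) : FiniteDimensional L E ∧ IsGalois L E := by
  obtain ⟨T, hT, hT'⟩ := IsGalois.is_separable_splitting_field F K
  rw [isSplittingField_iff_intermediateField] at hT'
  have : (T.map (algebraMap F L)).IsSplittingField L E := by
    rw [isSplittingField_iff_intermediateField]
    constructor
    · rw [Polynomial.map_map, ← IsScalarTower.algebraMap_eq]
      exact Splits.of_algHom hT'.1 (IsScalarTower.toAlgHom F K E)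
    · set M := adjoin L ((T.map (algebraMap F L)).rootSet E)
      have hle : adjoin F (T.rootSet K) ≤
          (M.restrictScalars F).comap (IsScalarTower.toAlgHom F K E) := by
        rw [adjoin_le_iff]
        intro x hx
        refine subset_adjoin L _ ?_
        rw [mem_rootSet'] at hx ⊢
        refine ⟨?_, ?_⟩
        · rw [Polynomial.map_map, ← IsScalarTower.algebraMap_eq]
          exact Polynomial.map_ne_zero hT.ne_zero
        · rw [aeval_map_algebraMap]
          exact (aeval_algHom_apply (IsScalarTower.toAlgHom F K E) x T).trans
            (by rw [hx.2, map_zero])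
      rw [hT'.2, top_le_iff] at hle
      rw [eq_top_iff, ← h, adjoin_le_iff]
      rintro _ ⟨x, rfl⟩
      exact hle.ge (mem_top (x := x))
  exact ⟨IsSplittingField.finiteDimensional E (T.map (algebraMap F L)),
    .of_separable_splitting_field (p := T.map (algebraMap F L)) hT.map⟩

section
variable (F : Type*) {K L E : Type*} [Field F] [Field K] [Field L] [Field E] [Algebra F K]
  [Algebra F L] [Algebra F E] [Algebra K E] [Algebra L E] [IsScalarTower F K E]
  [IsScalarTower F L E]

theorem algebraMap_restrictRestrictAlgEquivMapHom_apply [Normal F K] (φ : E ≃ₐ[L] E) (x : K) :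
    algebraMap K E (restrictRestrictAlgEquivMapHom F K L E φ x) = φ (algebraMap K E x) :=
  AlgEquiv.restrictNormal_commutes (MulSemiringAction.toAlgAut (E ≃ₐ[L] E) F E φ) K x

theorem restrictRestrictAlgEquivMapHom_injective_of_adjoin_range_eq_top [Normal F K]
    (h : adjoin L (Set.range (algebraMap K E)) = ⊤) :
    Function.Injective (restrictRestrictAlgEquivMapHom F K L E) := by
  refine (injective_iff_map_eq_one _).2 fun φ hφ ↦ ?_
  have hle : adjoin L (Set.range (algebraMap K E)) ≤ fixedField (Subgroup.zpowers φ) := by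
    rw [adjoin_le_iff]
    rintro _ ⟨x, rfl⟩
    have hx : φ ∈ MulAction.stabilizer (E ≃ₐ[L] E) (algebraMap K E x) := by
      rw [MulAction.mem_stabilizer_iff, AlgEquiv.smul_def,
        ← algebraMap_restrictRestrictAlgEquivMapHom_apply F, hφ, AlgEquiv.one_apply]
    rw [SetLike.mem_coe, mem_fixedField_iff]
    exact fun ψ hψ ↦ Subgroup.zpowers_le.2 hx hψ
  rw [h, le_iff_le, fixingSubgroup_top, le_bot_iff, Subgroup.zpowers_eq_bot] at hle
  exact hle

theorem finrank_eq_finrank_comap_of_adjoin_range_eq_top [IsGalois F K] [FiniteDimensional F K]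
    (h : adjoin L (Set.range (algebraMap K E)) = ⊤) :
    Module.finrank L E =
      Module.finrank ((IsScalarTower.toAlgHom F L E).fieldRange.comap
        (IsScalarTower.toAlgHom F K E)) K := by
  obtain ⟨_, _⟩ := finiteDimensional_and_isGalois_of_adjoin_range_eq_top F h
  have hfix : fixedField (restrictRestrictAlgEquivMapHom F K L E).range =
      (IsScalarTower.toAlgHom F L E).fieldRange.comap (IsScalarTower.toAlgHom F K E) := by
    ext x
    change _ ↔ algebraMap K E x ∈ Set.range (algebraMap L E)
    rw [IsGalois.mem_range_algebraMap_iff_fixed, mem_fixedField_iff]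
    simp only [MonoidHom.mem_range, forall_exists_index, forall_apply_eq_imp_iff,
      ← algebraMap_restrictRestrictAlgEquivMapHom_apply F, (algebraMap K E).injective.eq_iff]
  rw [← hfix, finrank_fixedField_eq_card, ← IsGalois.card_aut_eq_finrank]
  exact Nat.card_congr (MonoidHom.ofInjective
    (restrictRestrictAlgEquivMapHom_injective_of_adjoin_range_eq_top F h)).toEquiv

end

section
variable {k Ω : Type*} [Field k] [Field Ω] [Algebra k Ω]

theorem exists_injective_and_relfinrank_sup (A B : IntermediateField k Ω) [IsGalois k A]
    [FiniteDimensional k A] (h : B ≤ A ⊔ B) :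
    IsGalois B (extendScalars h) ∧
      (∃ f : (extendScalars h ≃ₐ[B] extendScalars h) →* (A ≃ₐ[k] A), Function.Injective f) ∧
      relfinrank B (A ⊔ B) = relfinrank B A := by
  let _ : Algebra A (extendScalars h) := (inclusion (le_sup_left : A ≤ A ⊔ B)).toRingHom.toAlgebra
  have : IsScalarTower k A (extendScalars h) := IsScalarTower.of_algebraMap_eq fun _ ↦ rfl
  have htop : adjoin B (Set.range (algebraMap A (extendScalars h))) = ⊤ := by
    set M := adjoin B (Set.range (algebraMap A (extendScalars h)))
    have hle : A ⊔ B ≤ (lift M).restrictScalars k := by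
      refine sup_le (fun x hx ↦ ?_) fun x hx ↦ ?_
      · exact ⟨algebraMap A (extendScalars h) ⟨x, hx⟩, subset_adjoin _ _ ⟨_, rfl⟩, rfl⟩
      · exact ⟨algebraMap B (extendScalars h) ⟨x, hx⟩, M.algebraMap_mem _, rfl⟩
    refine eq_top_iff.2 fun x _ ↦ ?_
    obtain ⟨y, hy, hyx⟩ := hle x.2
    exact Subtype.ext hyx ▸ hy
  obtain ⟨_, hgal⟩ := finiteDimensional_and_isGalois_of_adjoin_range_eq_top k htop
  refine ⟨hgal, ⟨restrictRestrictAlgEquivMapHom k A B _,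
    restrictRestrictAlgEquivMapHom_injective_of_adjoin_range_eq_top k htop⟩, ?_⟩
  rw [relfinrank_eq_finrank_of_le h, finrank_eq_finrank_comap_of_adjoin_range_eq_top k htop]
  have hcomap : (IsScalarTower.toAlgHom k B (extendScalars h)).fieldRange.comap
      (IsScalarTower.toAlgHom k A (extendScalars h)) = B.comap A.val := by
    ext x
    constructor
    · rintro ⟨z, hz⟩
      have hzx : (z : Ω) = x := congrArg Subtype.val hz
      exact (hzx ▸ z.2 : (x : Ω) ∈ B)
    · exact fun hx ↦ ⟨⟨x, hx⟩, rfl⟩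
  rw [hcomap, finrank_comap, fieldRange_val]

end

theorem IsCyclic.le_of_card_dvd_card {G : Type*} [Group G] [Finite G] [IsCyclic G]
    {H₁ H₂ : Subgroup G} (h : Nat.card H₁ ∣ Nat.card H₂) : H₁ ≤ H₂ := by
  classical
  have := Fintype.ofFinite G
  have hsub : (H₂ : Set G).toFinset ⊆ Finset.univ.filter (· ^ Nat.card H₂ = 1) := fun x hx ↦ by
    have h1 : (⟨x, Set.mem_toFinset.1 hx⟩ : H₂) ^ Nat.card H₂ = 1 := pow_card_eq_one'
    exact Finset.mem_filter_univ x |>.2 (congrArg Subtype.val h1)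
  have heq := Finset.eq_of_subset_of_card_le hsub <| by
    rw [Set.toFinset_card, ← Nat.card_eq_fintype_card]
    exact IsCyclic.card_pow_eq_one_le Nat.card_pos
  intro x hx
  have hx' : x ∈ (H₂ : Set G).toFinset := by
    rw [heq, Finset.mem_filter_univ]
    have h1 : (⟨x, hx⟩ : H₁) ^ Nat.card H₂ = 1 :=
      orderOf_dvd_iff_pow_eq_one.1 ((orderOf_dvd_natCard _).trans h)
    exact congrArg Subtype.val h1
  exact Set.mem_toFinset.1 hx'

theorem le_of_finrank_eq_prime {k A : Type*} [Field k] [Field A] [Algebra k A] [IsGalois k A]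
    [IsCyclic (A ≃ₐ[k] A)] {p n : ℕ} (hp : p.Prime) (hA : Module.finrank k A = p ^ n)
    {K D : IntermediateField k A} (hK : Module.finrank K A = p) (hD : D ≠ ⊤) : D ≤ K := by
  have : FiniteDimensional k A := Module.finite_of_finrank_pos (hA ▸ pow_pos hp.pos _)
  rw [← IsGalois.fixedField_fixingSubgroup D, ← IsGalois.fixedField_fixingSubgroup K]
  refine fixedField_le (IsCyclic.le_of_card_dvd_card ?_)
  rw [IsGalois.card_fixingSubgroup_eq_finrank, IsGalois.card_fixingSubgroup_eq_finrank, hK]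
  have hdvd : Module.finrank D A ∣ p ^ n :=
    hA ▸ Dvd.intro_left _ (Module.finrank_mul_finrank k D A)
  obtain ⟨m, -, hm⟩ := (Nat.dvd_prime_pow hp).1 hdvd
  rw [hm]
  refine dvd_pow_self p fun h0 ↦ hD ?_
  rw [h0, pow_zero] at hm
  exact finrank_eq_one_iff_eq_top.1 hm

/-- Let `k` be a field with `char k = p > 0` and let `K/k` be a nontrivial
cyclic extension of `p`-power degree, where `K` and `k'` are subfields of a common
overfield `Ω`.  Suppose `K' = K k'` is a nontrivial extension of `k'` (i.e. `K ⊄ k'`).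
Then there exists a field extension `L ⊇ K` with `[L:K] = p` such that `L/k` is cyclic;
and for any such `L` (inside `Ω`), the compositum `L K'` is cyclic over `k'` with
`[L K' : K'] = p`. -/
theorem stmt6 {k : Type u} [Field k] (p : ℕ) (hp : p.Prime) [CharP k p]
    (Ω : Type u) [Field Ω] [Algebra k Ω]
    (K k' : IntermediateField k Ω)
    [IsGalois k ↥K] [IsCyclic (↥K ≃ₐ[k] ↥K)]
    (e : ℕ) (hdeg : Module.finrank k ↥K = p ^ e) (hKnt : K ≠ ⊥)
    (hnt : ¬ K ≤ k') :
    (∃ (L : Type u) (_ : Field L) (_ : Algebra k L) (_ : Algebra ↥K L)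
        (_ : IsScalarTower k ↥K L),
        Module.finrank ↥K L = p ∧ IsGalois k L ∧ IsCyclic (L ≃ₐ[k] L)) ∧
      ∀ (L : IntermediateField k Ω) (hKL : K ≤ L),
        Module.finrank ↥K ↥(IntermediateField.extendScalars hKL) = p →
        IsGalois k ↥L → IsCyclic (↥L ≃ₐ[k] ↥L) →
        ∀ (hk'M : k' ≤ L ⊔ k') (hK'M : K ⊔ k' ≤ L ⊔ k'),
          IsGalois ↥k' ↥(IntermediateField.extendScalars hk'M) ∧
          IsCyclic (↥(IntermediateField.extendScalars hk'M) ≃ₐ[↥k']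
            ↥(IntermediateField.extendScalars hk'M)) ∧
          Module.finrank ↥(K ⊔ k' : IntermediateField k Ω)
            ↥(IntermediateField.extendScalars hK'M) = p := by
  have : Fact p.Prime := ⟨hp⟩
  have : FiniteDimensional k K := Module.finite_of_finrank_pos (hdeg ▸ pow_pos hp.pos _)
  constructor
  · obtain _ | e := e
    · exact absurd (finrank_eq_one_iff.1 hdeg) hKnt
    · exact exists_isCyclic_extension p hdeg
  intro L hKL hLK _ _ hk'M hK'M
  rw [← relfinrank_eq_finrank_of_le hKL] at hLK
  have hLdeg : Module.finrank k L = p ^ (e + 1) := by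
    rw [← relfinrank_bot_left, ← relfinrank_mul_relfinrank bot_le hKL, relfinrank_bot_left, hdeg,
      hLK, pow_succ]
  have : FiniteDimensional k L := Module.finite_of_finrank_pos (hLdeg ▸ pow_pos hp.pos _)
  obtain ⟨hgal, ⟨f, hf⟩, hLk'⟩ := exists_injective_and_relfinrank_sup L k' hk'M
  refine ⟨hgal, isCyclic_of_injective f hf, ?_⟩
  obtain ⟨-, -, hKk'⟩ := exists_injective_and_relfinrank_sup K k' le_sup_right
  have hinf : k' ⊓ L = k' ⊓ K := by
    have hle : k'.comap L.val ≤ K.comap L.val := by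
      refine le_of_finrank_eq_prime hp hLdeg ?_ fun htop ↦ hnt fun x hx ↦ ?_
      · rw [finrank_comap, fieldRange_val, hLK]
      · exact htop.ge (mem_top (x := ⟨x, hKL hx⟩))
    exact le_antisymm (fun x hx ↦ ⟨hx.1, hle (x := ⟨x, hx.2⟩) hx.1⟩) (inf_le_inf_left _ hKL)
  have hpos : 0 < relfinrank k' K := by
    rw [← fieldRange_val (S := K), ← finrank_comap]
    exact Module.finrank_pos
  rw [← relfinrank_eq_finrank_of_le hK'M]
  refine Nat.eq_of_mul_eq_mul_left hpos ?_
  rw [← hKk', relfinrank_mul_relfinrank le_sup_right hK'M, hLk', hKk', ← inf_relfinrank_left,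
    inf_comm, hinf, ← relfinrank_inf_mul_relfinrank, inf_eq_left.2 hKL, hLK]
end

section
/- Let K/F be a finite Galois extension with Galois group G, and let B be a finite-dimensional F-algebra containing K as a subfield (with 1_B ∈ K). If {z_σ}_{σ ∈ G} is a family of units of B such that z_σ x z_σ^{-1} = σ(x) for all x ∈ K and all σ ∈ G, then {z_σ}_{σ ∈ G} is both left and right linearly independent over the centralizer C_B(K) of K in B. -/
universe u

/-- A relation among vectors whose coefficients are the values of distinct monoid homomorphisms
into a field is trivial. -/
theorem eq_zero_of_forall_sum_monoidHom_smul_eq_zero {ι M K V : Type*} [Fintype ι] [Monoid M]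
    [Field K] [AddCommGroup V] [Module K V] {f : ι → M →* K} (hf : Function.Injective f)
    {w : ι → V} (hw : ∀ x, ∑ i, f i x • w i = 0) (i : ι) : w i = 0 := by
  rw [← Module.forall_dual_apply_eq_zero_iff K]
  intro φ
  have hli : LinearIndependent K fun i => (f i : M → K) :=
    (linearIndependent_monoidHom M K).comp f hf
  refine Fintype.linearIndependent_iff.mp hli (fun j => φ (w j)) ?_ i
  ext x
  simpa [mul_comm] using congrArg φ (hw x)

/-- Elements of a `K`-ring lying in the eigenspaces of distinct automorphisms of `K` and summing
to zero are all zero. -/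
theorem eq_zero_of_sum_eq_zero_of_mul_eq_algEquiv_mul {F K B : Type*} [Field F] [Field K]
    [Algebra F K] [FiniteDimensional F K] [Ring B] [Algebra F B] (incl : K →ₐ[F] B)
    {w : (K ≃ₐ[F] K) → B} (hw : ∀ σ x, w σ * incl x = incl (σ x) * w σ)
    (hsum : ∑ σ, w σ = 0) (σ : K ≃ₐ[F] K) : w σ = 0 := by
  let _ : Module K B := Module.compHom B (incl : K →+* B)
  refine eq_zero_of_forall_sum_monoidHom_smul_eq_zero
    (f := fun τ : K ≃ₐ[F] K => (τ : K →* K)) ?_ (fun x => ?_) σ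
  · intro τ τ' h
    ext x
    exact DFunLike.congr_fun h x
  · change ∑ τ : K ≃ₐ[F] K, incl (τ x) * w τ = 0
    simp_rw [← hw, ← Finset.sum_mul, hsum, zero_mul]

/-- Let `K/F` be a finite Galois extension with Galois group `G`, and
let `B` be a finite-dimensional `F`-algebra containing `K` as a subfield (via a unital
`F`-algebra embedding `incl : K →ₐ[F] B`).  If `z : G → Bˣ` is a family of units with
`z σ * x * (z σ)⁻¹ = σ x` for all `x ∈ K`, then the family `{z σ}` is both left and
right linearly independent over the centralizer `C_B(K)`. -/
theorem stmt18 {F K B : Type u} [Field F] [Field K] [Algebra F K]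
    [FiniteDimensional F K] [IsGalois F K]
    [Ring B] [Algebra F B] [FiniteDimensional F B]
    (incl : K →ₐ[F] B)
    (z : (K ≃ₐ[F] K) → Bˣ)
    (hz : ∀ (σ : K ≃ₐ[F] K) (x : K),
      (z σ : B) * incl x * ((z σ)⁻¹ : Bˣ) = incl (σ x)) :
    (∀ a : (K ≃ₐ[F] K) → B,
      (∀ σ, a σ ∈ Subalgebra.centralizer F (Set.range incl)) →
      ∑ σ : K ≃ₐ[F] K, a σ * (z σ : B) = 0 → ∀ σ, a σ = 0) ∧
    (∀ a : (K ≃ₐ[F] K) → B,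
      (∀ σ, a σ ∈ Subalgebra.centralizer F (Set.range incl)) →
      ∑ σ : K ≃ₐ[F] K, (z σ : B) * a σ = 0 → ∀ σ, a σ = 0) := by
  have hzx (σ : K ≃ₐ[F] K) (x : K) : (z σ : B) * incl x = incl (σ x) * z σ := by
    rw [← hz, Units.inv_mul_cancel_right]
  have hcomm {b : B} (hb : b ∈ Subalgebra.centralizer F (Set.range incl)) (x : K) :
      incl x * b = b * incl x :=
    Subalgebra.mem_centralizer_iff F |>.mp hb _ ⟨x, rfl⟩
  refine ⟨fun a ha hsum σ => ?_, fun a ha hsum σ => ?_⟩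
  · refine (Units.mul_left_eq_zero (z σ)).mp
      (eq_zero_of_sum_eq_zero_of_mul_eq_algEquiv_mul incl (fun τ x => ?_) hsum σ)
    rw [mul_assoc, hzx, ← mul_assoc, ← hcomm (ha τ), mul_assoc]
  · refine (Units.mul_right_eq_zero (z σ)).mp
      (eq_zero_of_sum_eq_zero_of_mul_eq_algEquiv_mul incl (fun τ x => ?_) hsum σ)
    rw [mul_assoc, ← hcomm (ha τ), ← mul_assoc, hzx, mul_assoc]
end

section
/- Let K/F be a finite Galois extension with Galois group G, let B be a finite-dimensional central simple F-algebra containing K as a subfield, and let A = C_B(K). Then there exists a family {z_σ}_{σ ∈ G} of units of B such that z_σ x z_σ^{-1} = σ(x) for all x ∈ K and all σ ∈ G, and any such family is a free set of generators of B over A; that is, B = ⊕_{σ ∈ G} A z_σ as a left A-module (the z_σ form a basis of B as a free left A-module). -/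
universe u

open scoped TensorProduct

section TensorProduct

variable {F B C ι : Type*} [Field F] [Ring B] [Algebra F B] [Ring C] [Algebra F C]

theorem Algebra.TensorProduct.basis_repr_mul_tmul_one (b : Module.Basis ι F C) (x : B ⊗[F] C)
    (a : B) (i : ι) :
    (Algebra.TensorProduct.basis B b).repr (x * (a ⊗ₜ[F] (1 : C))) i =
      (Algebra.TensorProduct.basis B b).repr x i * a := by
  induction x with
  | zero => simp
  | tmul u c => simp [mul_assoc, Algebra.commutes]
  | add x y hx hy => simp [add_mul, hx, hy]

theorem Algebra.TensorProduct.smul_eq_tmul_one_mul (x : B ⊗[F] C) (a : B) :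
    a • x = (a ⊗ₜ[F] (1 : C)) * x := by
  induction x with
  | zero => simp
  | tmul u c => simp [TensorProduct.smul_tmul']
  | add x y hx hy => simp [mul_add, hx, hy]

/-- A nonzero two-sided ideal of `B ⊗ C`, with `B` central simple, meets `1 ⊗ C` nontrivially. -/
theorem TwoSidedIdeal.exists_one_tmul_mem [Algebra.IsCentral F B] [IsSimpleRing B]
    (I : TwoSidedIdeal (B ⊗[F] C)) (hI : I ≠ ⊥) :
    ∃ c : C, c ≠ 0 ∧ (1 : B) ⊗ₜ[F] c ∈ I := by
  classical
  let b := Module.Basis.ofVectorSpace F C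
  let e := Algebra.TensorProduct.basis B b
  have hsmul : ∀ (a : B) {x}, x ∈ I → a • x ∈ I := fun a x hx ↦ by
    rw [Algebra.TensorProduct.smul_eq_tmul_one_mul]
    exact I.mul_mem_left _ _ hx
  have hne : ∃ n, ∃ x ∈ I, x ≠ 0 ∧ (e.repr x).support.card = n := by
    obtain ⟨x, hx, hx0⟩ := SetLike.exists_of_lt (bot_lt_iff_ne_bot.mpr hI)
    exact ⟨_, x, hx, hx0, rfl⟩
  obtain ⟨x, hxI, hx0, hxn⟩ := Nat.find_spec hne
  have hmin : ∀ y ∈ I, (e.repr y).support.card < (e.repr x).support.card → y = 0 := by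
    intro y hy hlt
    by_contra hy0
    exact Nat.find_min hne (hxn ▸ hlt) ⟨y, hy, hy0, rfl⟩
  obtain ⟨i, hi⟩ : ∃ i, e.repr x i ≠ 0 := by
    by_contra! h
    exact hx0 (e.repr.map_eq_zero_iff.mp (Finsupp.ext h))
  let J : TwoSidedIdeal B := TwoSidedIdeal.mk'
    {a | ∃ y ∈ I, (∀ j, e.repr x j = 0 → e.repr y j = 0) ∧ e.repr y i = a}
    ⟨0, I.zero_mem, by simp, by simp⟩
    (by
      rintro _ _ ⟨y, hy, hy', rfl⟩ ⟨z, hz, hz', rfl⟩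
      exact ⟨y + z, I.add_mem hy hz, fun j hj ↦ by simp [hy' j hj, hz' j hj], by simp⟩)
    (by
      rintro _ ⟨y, hy, hy', rfl⟩
      exact ⟨-y, I.neg_mem hy, fun j hj ↦ by simp [hy' j hj], by simp⟩)
    (by
      rintro a _ ⟨y, hy, hy', rfl⟩
      exact ⟨a • y, hsmul a hy, fun j hj ↦ by simp [hy' j hj], by simp⟩)
    (by
      rintro _ a ⟨y, hy, hy', rfl⟩
      refine ⟨y * (a ⊗ₜ 1), I.mul_mem_right _ _ hy, fun j hj ↦ ?_, ?_⟩
      · simp only [e, Algebra.TensorProduct.basis_repr_mul_tmul_one] at hy' ⊢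
        rw [hy' j hj, zero_mul]
      · exact Algebra.TensorProduct.basis_repr_mul_tmul_one b y a i)
  have hJ : (1 : B) ∈ J := by
    refine IsSimpleRing.one_mem_of_ne_zero_mem J hi ?_
    rw [TwoSidedIdeal.mem_mk']
    exact ⟨x, hxI, fun _ h ↦ h, rfl⟩
  rw [TwoSidedIdeal.mem_mk'] at hJ
  obtain ⟨y, hyI, hy, hy1⟩ := hJ
  have hcomm : ∀ (a : B) (j), a * e.repr y j = e.repr y j * a := by
    intro a j
    have hrepr : ∀ k, e.repr (a • y - y * (a ⊗ₜ 1)) k = a * e.repr y k - e.repr y k * a := by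
      intro k
      rw [map_sub, Finsupp.sub_apply, map_smul, Finsupp.smul_apply, smul_eq_mul,
        Algebra.TensorProduct.basis_repr_mul_tmul_one]
    have hw : a • y - y * (a ⊗ₜ 1) = 0 := by
      refine hmin _ (I.sub_mem (hsmul a hyI) (I.mul_mem_right _ _ hyI)) (Finset.card_lt_card ?_)
      refine Finset.ssubset_iff_of_subset (fun k hk ↦ ?_) |>.mpr ⟨i, by simpa using hi, ?_⟩
      · rw [Finsupp.mem_support_iff] at hk ⊢
        intro h
        exact hk (by rw [hrepr, hy k h, mul_zero, zero_mul, sub_zero])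
      · rw [Finsupp.notMem_support_iff, hrepr, hy1, mul_one, one_mul, sub_self]
    have := hrepr j
    rw [hw, map_zero, Finsupp.zero_apply] at this
    exact sub_eq_zero.mp this.symm
  have hcentral : ∀ j, ∃ f : F, e.repr y j = algebraMap F B f := fun j ↦
    (Algebra.IsCentral.mem_center_iff F).mp
      (Subalgebra.mem_center_iff.mpr fun a ↦ hcomm a j)
  choose f hf using hcentral
  have hy_eq : y = (1 : B) ⊗ₜ[F] ∑ j ∈ (e.repr y).support, f j • b j := by
    conv_lhs => rw [← e.linearCombination_repr y, Finsupp.linearCombination_apply, Finsupp.sum]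
    rw [TensorProduct.tmul_sum]
    refine Finset.sum_congr rfl fun j _ ↦ ?_
    rw [hf, algebraMap_smul, Algebra.TensorProduct.basis_apply, TensorProduct.tmul_smul]
  refine ⟨_, fun h0 ↦ ?_, hy_eq ▸ hyI⟩
  rw [h0, TensorProduct.tmul_zero] at hy_eq
  rw [hy_eq, map_zero, Finsupp.zero_apply] at hy1
  exact zero_ne_one hy1

theorem IsSimpleRing.tensorProduct [Algebra.IsCentral F B] [IsSimpleRing B] [IsSimpleRing C] :
    IsSimpleRing (B ⊗[F] C) := by
  refine .of_eq_bot_or_eq_top fun I ↦ or_iff_not_imp_left.mpr fun hI ↦ ?_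
  obtain ⟨c, hc, hcI⟩ := I.exists_one_tmul_mem hI
  have h : (1 : C) ∈ I.comap (Algebra.TensorProduct.includeRight : C →ₐ[F] B ⊗[F] C) :=
    IsSimpleRing.one_mem_of_ne_zero_mem _ hc ((TwoSidedIdeal.mem_comap _).mpr hcI)
  rw [← TwoSidedIdeal.one_mem_iff]
  exact (TwoSidedIdeal.mem_comap _).mp h

end TensorProduct

section SimpleArtinian

theorem IsSimpleRing.isIsotypicOfType_ideal {R : Type*} (X : Type*) [Ring R] [IsSimpleRing R]
    [IsArtinianRing R] [AddCommGroup X] [Module R X] (S : Submodule R R) [IsSimpleModule R S] :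
    IsIsotypicOfType R X S := by
  let e := S.equivMapOfInjective (LinearMap.inr R X R) LinearMap.inr_injective
  have := IsSimpleModule.congr e.symm
  exact ((IsSimpleRing.isIsotypic R (X × R) (S.map (LinearMap.inr R X R))).of_injective
    (LinearMap.inl R X R) LinearMap.inl_injective).of_linearEquiv_type e.symm

/-- Over a simple finite-dimensional algebra, modules are classified by their dimension. -/
theorem IsSimpleRing.nonempty_linearEquiv_of_finrank_eq (F R : Type*) {M N : Type*} [Field F]
    [Ring R] [Algebra F R] [IsSimpleRing R] [FiniteDimensional F R]
    [AddCommGroup M] [Module F M] [Module R M] [IsScalarTower F R M] [FiniteDimensional F M]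
    [AddCommGroup N] [Module F N] [Module R N] [IsScalarTower F R N] [FiniteDimensional F N]
    (h : Module.finrank F M = Module.finrank F N) : Nonempty (M ≃ₗ[R] N) := by
  have : IsArtinianRing R := IsArtinianRing.of_finite F R
  have : Module.Finite R M := Module.Finite.of_restrictScalars_finite F R M
  have : Module.Finite R N := Module.Finite.of_restrictScalars_finite F R N
  obtain ⟨S, hS⟩ := IsAtomic.exists_atom (Submodule R R)
  rw [← isSimpleModule_iff_isAtom] at hS
  obtain ⟨m, ⟨eM⟩⟩ := (IsSimpleRing.isIsotypicOfType_ideal M S).linearEquiv_fun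
  obtain ⟨n, ⟨eN⟩⟩ := (IsSimpleRing.isIsotypicOfType_ideal N S).linearEquiv_fun
  have hfin : FiniteDimensional F S :=
    FiniteDimensional.of_injective (S.subtype.restrictScalars F) S.subtype_injective
  have hpos : 0 < Module.finrank F S :=
    have := IsSimpleModule.nontrivial R S
    Module.finrank_pos
  have hmn : m = n := by
    rw [(eM.restrictScalars F).finrank_eq, (eN.restrictScalars F).finrank_eq,
      Module.finrank_pi_fintype, Module.finrank_pi_fintype] at h
    simpa [hpos.ne'] using h
  subst hmn
  exact ⟨eM.trans eN.symm⟩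

/-- Two representations of a simple finite-dimensional algebra of the same dimension are
equivalent. -/
theorem AlgHom.exists_intertwining_of_finrank_eq {F R V W : Type*} [Field F]
    [Ring R] [Algebra F R] [IsSimpleRing R] [FiniteDimensional F R]
    [AddCommGroup V] [Module F V] [FiniteDimensional F V]
    [AddCommGroup W] [Module F W] [FiniteDimensional F W]
    (h : Module.finrank F V = Module.finrank F W)
    (φ : R →ₐ[F] Module.End F V) (ψ : R →ₐ[F] Module.End F W) :
    ∃ e : V ≃+ W, ∀ r v, e (φ r v) = ψ r (e v) := by
  let _ : Module R V := Module.compHom V φ.toRingHom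
  let _ : Module R W := Module.compHom W ψ.toRingHom
  have : IsScalarTower F R V := ⟨fun a r v ↦ by
    change φ (a • r) v = a • φ r v
    rw [map_smul, LinearMap.smul_apply]⟩
  have : IsScalarTower F R W := ⟨fun a r v ↦ by
    change ψ (a • r) v = a • ψ r v
    rw [map_smul, LinearMap.smul_apply]⟩
  obtain ⟨e⟩ := IsSimpleRing.nonempty_linearEquiv_of_finrank_eq F R h
  exact ⟨e.toAddEquiv, fun r v ↦ e.map_smul r v⟩

/-- The **Skolem–Noether theorem** for embeddings of a finite field extension. -/
theorem AlgHom.exists_unit_conj_eq {F K B : Type*} [Field F] [Field K] [Algebra F K]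
    [FiniteDimensional F K] [Ring B] [Algebra F B] [FiniteDimensional F B]
    [Algebra.IsCentral F B] [IsSimpleRing B] (f g : K →ₐ[F] B) :
    ∃ u : Bˣ, ∀ x, (u : B) * f x * (u⁻¹ : Bˣ) = g x := by
  have : IsSimpleRing (B ⊗[F] K) := IsSimpleRing.tensorProduct
  let ρ (h : K →ₐ[F] B) : B ⊗[F] K →ₐ[F] Module.End F B :=
    Algebra.TensorProduct.lift (Algebra.lmul F B)
      (AlgHom.ofLinearMap ((LinearMap.mul F B).flip ∘ₗ h.toLinearMap)
        (by ext; simp)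
        (fun x y ↦ by ext; simp [mul_assoc, mul_comm x y]))
      (fun b x ↦ by
        ext m
        simp [mul_assoc])
  have hρ : ∀ h b x m, ρ h (b ⊗ₜ x) m = b * (m * h x) := fun h b x m ↦ by
    change (Algebra.lmul F B b * (LinearMap.mul F B).flip (h x)) m = _
    simp
  obtain ⟨e, he⟩ := AlgHom.exists_intertwining_of_finrank_eq rfl (ρ g) (ρ f)
  have he1 : ∀ b, e b = b * e 1 := fun b ↦ by simpa [hρ] using he (b ⊗ₜ 1) 1
  have hl : e.symm 1 * e 1 = 1 := by rw [← he1, e.apply_symm_apply]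
  have hr : e 1 * e.symm 1 = 1 := e.injective (by rw [he1, mul_assoc, hl, mul_one])
  refine ⟨⟨e 1, e.symm 1, hr, hl⟩, fun x ↦ ?_⟩
  have hx := he (1 ⊗ₜ x) 1
  rw [hρ, hρ, one_mul, one_mul, one_mul, he1] at hx
  rw [← hx, mul_assoc]
  simp [hr]

end SimpleArtinian

section Galois

variable {F K ι : Type*} [Field F] [Field K] [Algebra F K] [FiniteDimensional F K] [IsGalois F K]
  [Fintype ι] [DecidableEq ι] (e : Module.Basis ι F K)

theorem Module.Basis.sum_traceDual_mul_traceDual (σ τ : K ≃ₐ[F] K) [Decidable (σ = τ)] :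
    ∑ i, σ (e i) * τ (e.traceDual i) = if σ = τ then 1 else 0 := by
  classical
  let P : Matrix (K ≃ₐ[F] K) ι K := .of fun σ i ↦ σ (e i)
  let Q : Matrix ι (K ≃ₐ[F] K) K := .of fun i σ ↦ σ (e.traceDual i)
  have hcard : Fintype.card ι = Fintype.card (K ≃ₐ[F] K) := by
    rw [← Module.finrank_eq_card_basis e, ← Nat.card_eq_fintype_card, IsGalois.card_aut_eq_finrank]
  have hQP : Q * P = 1 := by
    ext i j
    simp only [Matrix.mul_apply, P, Q, Matrix.of_apply, Matrix.one_apply]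
    simp_rw [← map_mul]
    rw [← trace_eq_sum_automorphisms, e.trace_traceDual_mul]
    split_ifs <;> simp_all
  have hPQ : P * Q = 1 := (Matrix.mul_eq_one_comm_of_card_eq _ _ _ hcard).mp hQP
  have h := congrFun (congrFun hPQ σ) τ
  rw [Matrix.mul_apply, Matrix.one_apply] at h
  convert h <;> rfl

theorem Module.Basis.sum_trace_mul_smul_traceDual (x : K) :
    ∑ i, Algebra.trace F K (x * e i) • e.traceDual i = x := by
  conv_rhs => rw [← e.traceDual.sum_repr x]
  simp [Algebra.traceForm_apply]

theorem Module.Basis.sum_trace_mul_traceDual_smul (x : K) :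
    ∑ i, Algebra.trace F K (x * e.traceDual i) • e i = x := by
  simpa using e.traceDual.sum_trace_mul_smul_traceDual x

variable {B : Type*} [Ring B] [Algebra F B] (f : K →ₐ[F] B)

/-- The component of `b` in `{b | ∀ x, b * f x = f (σ x) * b}`, in terms of a basis of `K`. -/
noncomputable def Module.Basis.twistedComponent (σ : K ≃ₐ[F] K) (b : B) : B :=
  ∑ i, f (σ (e i)) * b * f (e.traceDual i)

theorem Module.Basis.twistedComponent_mul (σ : K ≃ₐ[F] K) (b : B) (x : K) :
    e.twistedComponent f σ b * f x = f (σ x) * e.twistedComponent f σ b := by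
  have hl : ∀ i, f (σ (e i)) * b * f (e.traceDual i) * f x =
      ∑ j, Algebra.trace F K (e.traceDual i * x * e j) •
        (f (σ (e i)) * b * f (e.traceDual j)) := fun i ↦ by
    rw [mul_assoc, ← map_mul]
    conv_lhs => rw [← e.sum_trace_mul_smul_traceDual (e.traceDual i * x)]
    simp [Finset.mul_sum]
  have hr : ∀ j, f (σ x) * (f (σ (e j)) * b * f (e.traceDual j)) =
      ∑ i, Algebra.trace F K (e.traceDual i * x * e j) •
        (f (σ (e i)) * b * f (e.traceDual j)) := fun j ↦ by
    rw [← mul_assoc, ← mul_assoc, ← map_mul, ← map_mul]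
    conv_lhs => rw [← e.sum_trace_mul_traceDual_smul (x * e j)]
    simp only [map_sum, map_smul, Finset.sum_mul, smul_mul_assoc]
    exact Finset.sum_congr rfl fun i _ ↦ by
      rw [mul_comm (x * e j), ← mul_assoc (e.traceDual i)]
  simp only [twistedComponent, Finset.sum_mul, Finset.mul_sum, hl, hr]
  exact Finset.sum_comm

theorem Module.Basis.sum_twistedComponent (b : B) : ∑ σ, e.twistedComponent f σ b = b := by
  simp only [twistedComponent]
  rw [Finset.sum_comm]
  have : ∀ i, ∑ σ : K ≃ₐ[F] K, f (σ (e i)) * b * f (e.traceDual i) =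
      b * f (Algebra.trace F K (1 * e i) • e.traceDual i) := fun i ↦ by
    rw [← Finset.sum_mul, ← Finset.sum_mul, ← map_sum, ← trace_eq_sum_automorphisms, f.commutes,
      Algebra.commutes, mul_assoc, map_smul, Algebra.smul_def, one_mul]
  simp_rw [this]
  rw [← Finset.mul_sum, ← map_sum, e.sum_trace_mul_smul_traceDual, map_one, mul_one]

theorem Module.Basis.twistedComponent_sum (c : (K ≃ₐ[F] K) → B)
    (hc : ∀ σ x, c σ * f x = f (σ x) * c σ) (τ : K ≃ₐ[F] K) :
    e.twistedComponent f τ (∑ σ, c σ) = c τ := by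
  classical
  simp only [twistedComponent, Finset.mul_sum, Finset.sum_mul]
  rw [Finset.sum_comm]
  have : ∀ σ, ∑ i, f (τ (e i)) * c σ * f (e.traceDual i) = if τ = σ then c σ else 0 := fun σ ↦ by
    simp_rw [mul_assoc, hc, ← mul_assoc, ← map_mul, ← Finset.sum_mul, ← map_sum,
      e.sum_traceDual_mul_traceDual]
    split_ifs <;> simp
  simp [this]

end Galois

/-- Let `K/F` be a finite Galois extension with Galois group `G`, let
`B` be a finite-dimensional central simple `F`-algebra containing `K` as a subfield (via
an `F`-algebra embedding `incl : K →ₐ[F] B`), and let `A = C_B(K)` be the centralizer of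
`K` in `B`.  Then there exists a family `{z σ}_{σ ∈ G}` of units of `B` with
`z σ * x * (z σ)⁻¹ = σ x` for all `x ∈ K`, and any such family is a free set of
generators of `B` over `A`: every `b ∈ B` is uniquely of the form `b = Σ_σ a_σ * z σ`
with all `a_σ ∈ A`. -/
theorem stmt19 {F K B : Type u} [Field F] [Field K] [Algebra F K]
    [FiniteDimensional F K] [IsGalois F K]
    [Ring B] [Algebra F B] [FiniteDimensional F B]
    [Algebra.IsCentral F B] [IsSimpleRing B]
    (incl : K →ₐ[F] B) :
    (∃ z : (K ≃ₐ[F] K) → Bˣ, ∀ (σ : K ≃ₐ[F] K) (x : K),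
      (z σ : B) * incl x * ((z σ)⁻¹ : Bˣ) = incl (σ x)) ∧
    ∀ z : (K ≃ₐ[F] K) → Bˣ,
      (∀ (σ : K ≃ₐ[F] K) (x : K),
        (z σ : B) * incl x * ((z σ)⁻¹ : Bˣ) = incl (σ x)) →
      ∀ b : B, ∃! a : (K ≃ₐ[F] K) → B,
        (∀ σ, a σ ∈ Subalgebra.centralizer F (Set.range incl)) ∧
        b = ∑ σ : K ≃ₐ[F] K, a σ * (z σ : B) := by
  refine ⟨?_, fun z hz b ↦ ?_⟩
  · choose z hz using fun σ : K ≃ₐ[F] K ↦ incl.exists_unit_conj_eq (incl.comp (σ : K →ₐ[F] K))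
    exact ⟨z, hz⟩
  have hz' : ∀ σ x, (z σ : B) * incl x = incl (σ x) * z σ := fun σ x ↦ by
    rw [← hz, Units.inv_mul_cancel_right]
  have hz_inv : ∀ σ x, ((z σ)⁻¹ : Bˣ) * incl (σ x) = incl x * ((z σ)⁻¹ : Bˣ) := fun σ x ↦ by
    rw [← hz, mul_assoc, Units.inv_mul_cancel_left]
  let e := Module.finBasis F K
  refine ⟨fun σ ↦ e.twistedComponent incl σ b * ((z σ)⁻¹ : Bˣ), ⟨fun σ ↦ ?_, ?_⟩, ?_⟩
  · rw [Subalgebra.mem_centralizer_iff]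
    rintro _ ⟨x, rfl⟩
    obtain ⟨x, rfl⟩ := σ.surjective x
    rw [mul_assoc, hz_inv, ← mul_assoc, ← mul_assoc, e.twistedComponent_mul]
  · simp [e.sum_twistedComponent]
  · rintro a ⟨ha, rfl⟩
    funext σ
    rw [e.twistedComponent_sum incl (fun σ ↦ a σ * z σ) fun σ x ↦ ?_, Units.mul_inv_cancel_right]
    rw [mul_assoc, hz', ← mul_assoc, ← mul_assoc,
      Subalgebra.mem_centralizer_iff F |>.mp (ha σ) _ ⟨_, rfl⟩]
end
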